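/- arXiv:2105.15150 — 4 statements merged into one kernel-verified Lean document; each statement's English description precedes it below -/
import Mathlib

section
/- For any complex vectors X=(x_1,...,x_N) and Y=(y_1,...,y_N) with x_i ≠ y_j for all i,j, and any complex number z, the sum over a,b from 1 to N of (-1)^{a+b} y_b times the minor determinant det[ z/(x_i - y_j) · (y_j/x_i) + 1/(y_j - x_i) · (x_i/y_j) ] (rows i≠a, columns j≠b) equals (1-z)^{N-2} · ( Ĥ(X;Y) + z·(∏_i y_i/x_i)·Ĥ(Y;X) ) · det[1/(y_j - x_i)]_{i,j=1}^N, where Ĥ(W;W') := (1/2)(∑_i w_i − ∑_{i'} w'_{i'})^2 − (1/2)(∑_i w_i^2 − ∑_{i'} (w'_{i'})^2). -/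
open Finset

/-- `Ĥ(W;W') = (1/2)(∑ wᵢ − ∑ w'ᵢ)² − (1/2)(∑ wᵢ² − ∑ (w'ᵢ)²)`. -/
noncomputable def Hhat {N : ℕ} (W W' : Fin N → ℂ) : ℂ :=
  (1 / 2) * ((∑ i, W i) - ∑ i, W' i) ^ 2 - (1 / 2) * ((∑ i, (W i) ^ 2) - ∑ i, (W' i) ^ 2)

lemma aux_border {m : ℕ} (M : Matrix (Fin (m+1)) (Fin (m+1)) ℂ) (y : Fin (m+1) → ℂ) :
    (∑ a : Fin (m+1), ∑ b : Fin (m+1), (-1 : ℂ) ^ (a.1 + b.1) * y b *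
      Matrix.det (M.submatrix a.succAbove b.succAbove))
    = M.det - (M - Matrix.of fun _ j => y j).det := by
  set B : Matrix (Fin (m+2)) (Fin (m+2)) ℂ :=
    Matrix.of (Fin.cons (Fin.cons 1 y) (fun i => Fin.cons 1 (M i))) with hB
  have h1 : B.det = M.det - ∑ a : Fin (m+1), ∑ b : Fin (m+1), (-1 : ℂ) ^ (a.1 + b.1) * y b *
      Matrix.det (M.submatrix a.succAbove b.succAbove) := by
    rw [Matrix.det_succ_row_zero, Fin.sum_univ_succ]
    have e0 : B.submatrix Fin.succ (Fin.succAbove 0) = M := by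
      ext i j; simp [hB]
    rw [e0, sub_eq_add_neg]
    congr 1
    · simp [hB]
    rw [Finset.sum_comm, ← Finset.sum_neg_distrib]
    refine Finset.sum_congr rfl fun b _ => ?_
    rw [Matrix.det_succ_column_zero, Finset.mul_sum, ← Finset.sum_neg_distrib]
    refine Finset.sum_congr rfl fun a _ => ?_
    have e1 : (B.submatrix Fin.succ b.succ.succAbove).submatrix a.succAbove Fin.succ
        = M.submatrix a.succAbove b.succAbove := by
      ext i j; simp [hB]
    rw [e1]
    simp [hB, pow_add, pow_succ]
    ring
  have h2 : B.det = (M - Matrix.of fun _ j => y j).det := by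
    set Bred : Matrix (Fin (m+2)) (Fin (m+2)) ℂ :=
      Matrix.of (Fin.cons (Fin.cons 1 y) (fun i => Fin.cons 0 (fun j => M i j - y j))) with hBred
    have : B.det = Bred.det := by
      refine Matrix.det_eq_of_forall_row_eq_smul_add_const (Fin.cons 0 (fun _ => 1)) 0 (by simp) ?_
      intro i j
      refine Fin.cases ?_ (fun i => ?_) i
      · simp [hB, hBred]
      · refine Fin.cases ?_ (fun j => ?_) j
        · simp [hB, hBred]
        · simp [hB, hBred]
    rw [this, Matrix.det_succ_column_zero, Fin.sum_univ_succ]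
    have e0 : Bred.submatrix (Fin.succAbove 0) Fin.succ = (M - Matrix.of fun _ j => y j) := by
      ext i j; simp [hBred]
    rw [e0]
    simp [hBred]
  rw [← h2, h1]; ring

open Matrix in
lemma aux_rank_two {n : ℕ} (C : Matrix (Fin (n+2)) (Fin (n+2)) ℂ) (a b c d w v : Fin (n+2) → ℂ)
    (hC : IsUnit C.det) (hw : C *ᵥ w = a) (hv : C *ᵥ v = c) (l : ℂ) :
    (l • C - Matrix.of fun i j => a i * b j + c i * d j).det =
      l ^ n * C.det * ((l - b ⬝ᵥ w) * (l - d ⬝ᵥ v) - (b ⬝ᵥ v) * (d ⬝ᵥ w)) := by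
  have key : ∀ l : ℂ, l ≠ 0 → (l • C - Matrix.of fun i j => a i * b j + c i * d j).det =
      l ^ n * C.det * ((l - b ⬝ᵥ w) * (l - d ⬝ᵥ v) - (b ⬝ᵥ v) * (d ⬝ᵥ w)) := by
    intro l hl
    set U : Matrix (Fin (n+2)) (Fin 2) ℂ := Matrix.of fun i k => ![w i, v i] k
    set V : Matrix (Fin 2) (Fin (n+2)) ℂ := Matrix.of ![b, d]
    have e : (l • C - Matrix.of fun i j => a i * b j + c i * d j)
        = (l • C) * (1 + ((-l⁻¹) • U) * V) := by
      rw [mul_add, mul_one, sub_eq_add_neg]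
      congr 1
      have : (l • C) * (((-l⁻¹) • U) * V) = - ((C * U) * V) := by
        simp [hl, Matrix.mul_assoc, smul_smul]
      rw [this, ← hw, ← hv]
      congr 1
      ext i j
      simp [Matrix.mul_apply, Fin.sum_univ_two, U, V, Matrix.mulVec, dotProduct]
    rw [e, Matrix.det_mul, Matrix.det_one_add_mul_comm, Matrix.det_smul, Matrix.det_fin_two]
    have e00 : (V * (-l⁻¹ • U)) 0 0 = -l⁻¹ * (b ⬝ᵥ w) := by
      rw [Matrix.mul_smul]; simp only [Matrix.smul_apply, smul_eq_mul]; rfl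
    have e01 : (V * (-l⁻¹ • U)) 0 1 = -l⁻¹ * (b ⬝ᵥ v) := by
      rw [Matrix.mul_smul]; simp only [Matrix.smul_apply, smul_eq_mul]; rfl
    have e10 : (V * (-l⁻¹ • U)) 1 0 = -l⁻¹ * (d ⬝ᵥ w) := by
      rw [Matrix.mul_smul]; simp only [Matrix.smul_apply, smul_eq_mul]; rfl
    have e11 : (V * (-l⁻¹ • U)) 1 1 = -l⁻¹ * (d ⬝ᵥ v) := by
      rw [Matrix.mul_smul]; simp only [Matrix.smul_apply, smul_eq_mul]; rfl
    simp only [Matrix.add_apply, e00, e01, e10, e11, Matrix.one_apply, Fintype.card_fin]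
    simp only [Fin.isValue, zero_ne_one, one_ne_zero, if_true, if_false]
    rw [pow_add]
    field_simp
    ring
  have hc := Continuous.ext_on (s := {(0:ℂ)}ᶜ) (dense_compl_singleton (0:ℂ))
    (f := fun l : ℂ => (l • C - Matrix.of fun i j => a i * b j + c i * d j).det)
    (g := fun l : ℂ => l ^ n * C.det * ((l - b ⬝ᵥ w) * (l - d ⬝ᵥ v) - (b ⬝ᵥ v) * (d ⬝ᵥ w)))
    (Continuous.matrix_det (by fun_prop)) (by fun_prop) (fun l hl => key l hl)
  exact congrFun hc l

open Polynomial in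
noncomputable def auxP {ι : Type*} (s : Finset ι) (y : ι → ℂ) : ℂ[X] :=
  ∏ k ∈ s, (1 - C (y k) * X)

open Polynomial in
lemma auxP_coeff {ι : Type*} (s : Finset ι) (y : ι → ℂ) :
    (auxP s y).coeff 0 = 1 ∧ (auxP s y).coeff 1 = - ∑ k ∈ s, y k ∧
    (auxP s y).coeff 2 = (1/2) * ((∑ k ∈ s, y k)^2 - ∑ k ∈ s, (y k)^2) := by
  classical
  induction s using Finset.induction_on with
  | empty => simp [auxP, coeff_one]
  | insert a s ha ih =>
    obtain ⟨h0, h1, h2⟩ := ih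
    have e : auxP (insert a s) y = auxP s y - C (y a) * (auxP s y * X) := by
      rw [auxP, Finset.prod_insert ha, ← auxP]; ring
    rw [e]
    have x1 : (auxP s y * X).coeff 1 = 1 := by rw [← h0]; exact coeff_mul_X _ 0
    have x2 : (auxP s y * X).coeff 2 = - ∑ k ∈ s, y k := by rw [← h1]; exact coeff_mul_X _ 1
    simp only [coeff_sub, coeff_C_mul, coeff_mul_X_zero, h0, h1, h2, x1, x2,
      Finset.sum_insert ha]
    refine ⟨by ring, by ring, by ring⟩

open Polynomial in
lemma auxP_natDegree {ι : Type*} (s : Finset ι) (y : ι → ℂ) : (auxP s y).natDegree ≤ #s := by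
  refine (natDegree_prod_le _ _).trans ?_
  rw [Finset.card_eq_sum_ones]
  refine Finset.sum_le_sum fun i _ => ?_
  compute_degree

open Polynomial in
lemma auxP_top {ι : Type*} (s : Finset ι) (y : ι → ℂ) : (auxP s y).coeff #s = ∏ k ∈ s, (- y k) := by
  have := coeff_prod_of_natDegree_le s (fun k => (1 - C (y k) * X : ℂ[X])) 1
    (fun i _ => by compute_degree)
  rw [mul_one] at this
  rw [auxP, this]
  refine Finset.prod_congr rfl fun i _ => ?_
  simp [coeff_one]

open Polynomial in
noncomputable def auxQ {m : ℕ} (y w : Fin (m+1) → ℂ) : ℂ[X] :=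
  ∑ j, C (w j) * auxP (univ.erase j) y

open Polynomial in
lemma auxQ_natDegree {m : ℕ} (y w : Fin (m+1) → ℂ) : (auxQ y w).natDegree ≤ m := by
  refine natDegree_sum_le_of_forall_le _ _ fun j _ => ?_
  refine (natDegree_C_mul_le _ _).trans ((auxP_natDegree _ _).trans ?_)
  simp

open Polynomial in
lemma auxQ_coeff {m : ℕ} (y w : Fin (m+1) → ℂ) :
    (auxQ y w).coeff 0 = ∑ j, w j ∧
    (auxQ y w).coeff 1 = - (∑ k, y k) * (∑ j, w j) + ∑ j, y j * w j := by
  constructor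
  · simp [auxQ, finsetSum_coeff, (auxP_coeff _ y).1]
  · simp only [auxQ, finsetSum_coeff, coeff_C_mul, (auxP_coeff _ y).2.1]
    rw [Finset.mul_sum, ← Finset.sum_add_distrib]
    refine Finset.sum_congr rfl fun j _ => ?_
    rw [← Finset.add_sum_erase univ y (Finset.mem_univ j)]
    ring

open Polynomial in
lemma auxQ_eval {m : ℕ} (y w : Fin (m+1) → ℂ) (x : ℂ) (hx : x ≠ 0) (hxy : ∀ j, x ≠ y j) :
    (auxQ y w).eval x⁻¹ = - x * (∑ j, 1 / (y j - x) * w j) * (auxP univ y).eval x⁻¹ := by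
  rw [auxQ, eval_finsetSum, Finset.mul_sum, Finset.sum_mul]
  refine Finset.sum_congr rfl fun j _ => ?_
  have h : (auxP univ y).eval x⁻¹ = (1 - y j * x⁻¹) * (auxP (univ.erase j) y).eval x⁻¹ := by
    rw [auxP, ← Finset.mul_prod_erase univ _ (Finset.mem_univ j), ← auxP]
    simp
  rw [h]
  have h2 : y j - x ≠ 0 := sub_ne_zero.mpr (hxy j).symm
  simp only [eval_mul, eval_C]
  field_simp
  ring

open Polynomial in
lemma auxP_root {m : ℕ} (x : Fin (m+1) → ℂ) (hx : ∀ i, x i ≠ 0) (i : Fin (m+1)) :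
    (auxP univ x).eval (x i)⁻¹ = 0 := by
  rw [auxP, eval_prod]
  exact Finset.prod_eq_zero (Finset.mem_univ i) (by simp [hx i])

open Polynomial in
lemma aux_zero {m : ℕ} (x : Fin (m+1) → ℂ) (hinj : Function.Injective x)
    (p : ℂ[X]) (hp : p.natDegree ≤ m) (h : ∀ i, p.eval (x i)⁻¹ = 0) : p = 0 := by
  refine Polynomial.eq_zero_of_degree_lt_of_eval_index_eq_zero (s := univ) (v := fun i => (x i)⁻¹)
    (fun i _ j _ hij => hinj (inv_injective hij)) ?_ (fun i _ => h i)
  refine lt_of_le_of_lt (degree_le_of_natDegree_le hp) ?_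
  rw [Finset.card_univ, Fintype.card_fin]
  exact_mod_cast Nat.lt_succ_self m

open Polynomial in
lemma aux_ker {m : ℕ} (x y w : Fin (m+1) → ℂ) (hx : ∀ i, x i ≠ 0) (hy : ∀ j, y j ≠ 0)
    (hxy : ∀ i j, x i ≠ y j) (hxi : Function.Injective x) (hyi : Function.Injective y)
    (hw : ∀ i, ∑ j, 1 / (y j - x i) * w j = 0) : w = 0 := by
  have h0 : auxQ y w = 0 := aux_zero x hxi _ (auxQ_natDegree y w) fun i => by
    rw [auxQ_eval y w _ (hx i) (hxy i), hw i]; simp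
  funext j
  have h1 : (auxQ y w).eval (y j)⁻¹ = 0 := by rw [h0]; simp
  rw [auxQ, eval_finsetSum, Finset.sum_eq_single j] at h1
  · rw [eval_mul, eval_C, mul_eq_zero] at h1
    rcases h1 with h1 | h1
    · exact h1
    · exfalso
      rw [auxP, eval_prod, Finset.prod_eq_zero_iff] at h1
      obtain ⟨k, hk, h2⟩ := h1
      have hkj : k ≠ j := (Finset.mem_erase.mp hk).1
      apply hkj
      apply hyi
      simp only [eval_sub, eval_one, eval_mul, eval_C, eval_X] at h2
      have := hy j
      field_simp at h2
      linear_combination -h2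
  · intro b _ hb
    rw [eval_mul]
    have : (auxP (univ.erase b) y).eval (y j)⁻¹ = 0 := by
      rw [auxP, eval_prod]
      exact Finset.prod_eq_zero (Finset.mem_erase.mpr ⟨hb.symm, Finset.mem_univ j⟩)
        (by simp [hy j])
    rw [this, mul_zero]
  · intro h; exact absurd (Finset.mem_univ j) h

open Polynomial in
lemma aux_w {m : ℕ} (x y w : Fin (m+1) → ℂ) (hx : ∀ i, x i ≠ 0)
    (hxy : ∀ i j, x i ≠ y j) (hxi : Function.Injective x)
    (hw : ∀ i, ∑ j, 1 / (y j - x i) * w j = 1) :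
    ∑ j, w j = ∑ j, y j - ∑ i, x i ∧ ∑ j, y j * w j = Hhat x y := by
  have h0 : auxP univ y + X * auxQ y w - auxP univ x = 0 := by
    obtain ⟨q, hq⟩ : X ∣ auxP univ y + X * auxQ y w - auxP univ x := by
      rw [X_dvd_iff]
      simp only [coeff_sub, coeff_add, (auxP_coeff _ y).1, (auxP_coeff _ x).1,
        mul_coeff_zero, coeff_X_zero]
      ring
    have hd : (auxP univ y + X * auxQ y w - auxP univ x).natDegree ≤ m + 1 := by
      have a1 := auxP_natDegree univ y
      have a2 := auxP_natDegree univ x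
      have a3 := auxQ_natDegree y w
      rw [Finset.card_univ, Fintype.card_fin] at a1 a2
      refine (natDegree_sub_le_of_le (natDegree_add_le_of_degree_le a1 ?_) a2).trans (by simp)
      refine natDegree_mul_le.trans ?_
      rw [natDegree_X]; omega
    by_cases hq0 : q = 0
    · rw [hq, hq0, mul_zero]
    rw [hq, aux_zero x hxi q ?_ ?_, mul_zero]
    · rw [hq, natDegree_X_mul hq0] at hd; omega
    · intro i
      have := congrArg (eval (x i)⁻¹) hq
      simp only [eval_sub, eval_add, eval_mul, eval_X, auxP_root x hx i,
        auxQ_eval y w _ (hx i) (hxy i), hw i] at this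
      have hxi := hx i
      have h3 : (x i)⁻¹ * eval (x i)⁻¹ q = 0 := by
        rw [← this]; field_simp; ring
      rcases mul_eq_zero.mp h3 with h | h
      · exact absurd h (inv_ne_zero hxi)
      · exact h
  have x1 : (X * auxQ y w).coeff 1 = ∑ j, w j :=
    (coeff_X_mul _ 0).trans (auxQ_coeff y w).1
  have x2 : (X * auxQ y w).coeff 2 = _ := (coeff_X_mul _ 1).trans (auxQ_coeff y w).2
  have c1 := congrArg (fun p => coeff p 1) h0
  have c2 := congrArg (fun p => coeff p 2) h0
  simp only [coeff_sub, coeff_add, coeff_zero, (auxP_coeff _ y).2.1, (auxP_coeff _ x).2.1,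
    (auxP_coeff _ y).2.2, (auxP_coeff _ x).2.2, x1, x2] at c1 c2
  have d1 : ∑ j, w j = ∑ j, y j - ∑ i, x i := by linear_combination c1
  refine ⟨d1, ?_⟩
  rw [d1] at c2
  rw [Hhat]
  linear_combination c2

open Polynomial in
lemma aux_v {m : ℕ} (x y v : Fin (m+1) → ℂ) (hx : ∀ i, x i ≠ 0)
    (hxy : ∀ i j, x i ≠ y j) (hxi : Function.Injective x)
    (hv : ∀ i, ∑ j, 1 / (y j - x i) * v j = 1 / x i) :
    ∑ j, v j = (∏ i, y i / x i) - 1 ∧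
    ∑ j, y j * v j = (∏ i, y i / x i) * (∑ j, y j - ∑ i, x i) := by
  set P := ∏ i, y i / x i with hP
  have h0 : auxP univ y + auxQ y v - C P * auxP univ x = 0 := by
    have a1 := auxP_natDegree univ y
    have a2 := auxP_natDegree univ x
    have a3 := auxQ_natDegree y v
    have t1 := auxP_top univ y
    have t2 := auxP_top univ x
    rw [Finset.card_univ, Fintype.card_fin] at a1 a2 t1 t2
    refine aux_zero x hxi _ ?_ ?_
    · rw [natDegree_le_iff_coeff_eq_zero]
      intro k hk
      rcases eq_or_lt_of_le (Nat.succ_le_of_lt hk) with h | h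
      · rw [← h]
        simp only [coeff_sub, coeff_add, coeff_C_mul, Nat.succ_eq_add_one, t1, t2]
        rw [coeff_eq_zero_of_natDegree_lt (lt_of_le_of_lt a3 (Nat.lt_succ_self m)), hP,
          ← Finset.prod_mul_distrib, add_zero, sub_eq_zero]
        refine Finset.prod_congr rfl fun i _ => ?_
        have := hx i
        field_simp
      · simp only [coeff_sub, coeff_add, coeff_C_mul]
        rw [coeff_eq_zero_of_natDegree_lt (lt_of_le_of_lt a1 h),
          coeff_eq_zero_of_natDegree_lt (lt_of_le_of_lt a2 h),
          coeff_eq_zero_of_natDegree_lt (lt_of_le_of_lt a3 hk)]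
        simp
    · intro i
      simp only [eval_sub, eval_add, eval_mul, auxP_root x hx i,
        auxQ_eval y v _ (hx i) (hxy i), hv i]
      have := hx i
      field_simp
      ring
  have c0 := congrArg (fun p => coeff p 0) h0
  have c1 := congrArg (fun p => coeff p 1) h0
  simp only [coeff_sub, coeff_add, coeff_zero, coeff_C_mul, (auxP_coeff _ y).1,
    (auxP_coeff _ x).1, (auxQ_coeff y v).1] at c0
  simp only [coeff_sub, coeff_add, coeff_zero, coeff_C_mul, (auxP_coeff _ y).2.1,
    (auxP_coeff _ x).2.1, (auxQ_coeff y v).2] at c1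
  have d1 : ∑ j, v j = P - 1 := by linear_combination c0
  refine ⟨d1, ?_⟩
  rw [d1] at c1
  linear_combination c1

/-- Lemma 2.6 of the paper: a generalized Cauchy determinant summation identity. -/
theorem stmt0 (n : ℕ) (x y : Fin (n + 2) → ℂ)
    (hx : ∀ i, x i ≠ 0) (hy : ∀ j, y j ≠ 0)
    (hxy : ∀ i j, x i ≠ y j) (z : ℂ) :
    (∑ a : Fin (n + 2), ∑ b : Fin (n + 2), (-1 : ℂ) ^ (a.1 + b.1) * y b *
      Matrix.det ((Matrix.of fun i j : Fin (n + 2) =>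
        z / (x i - y j) * (y j / x i) + 1 / (y j - x i) * (x i / y j)).submatrix
          a.succAbove b.succAbove))
    = (1 - z) ^ n *
      (Hhat x y + z * (∏ i, y i / x i) * Hhat y x) *
      Matrix.det (Matrix.of fun i j : Fin (n + 2) => 1 / (y j - x i)) := by
  rw [aux_border]
  by_cases hxi : Function.Injective x
  swap
  · simp only [Function.Injective, not_forall] at hxi
    obtain ⟨i, j, hij, hne⟩ := hxi
    rw [Matrix.det_zero_of_row_eq hne (by ext k; simp [hij]),
      Matrix.det_zero_of_row_eq hne (by ext k; simp [hij]),
      Matrix.det_zero_of_row_eq hne (by ext k; simp [hij])]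
    simp
  by_cases hyi : Function.Injective y
  swap
  · simp only [Function.Injective, not_forall] at hyi
    obtain ⟨i, j, hij, hne⟩ := hyi
    rw [Matrix.det_zero_of_column_eq hne (by intro k; simp [hij]),
      Matrix.det_zero_of_column_eq hne (by intro k; simp [hij]),
      Matrix.det_zero_of_column_eq hne (by intro k; simp [hij])]
    simp
  set C : Matrix (Fin (n+2)) (Fin (n+2)) ℂ := Matrix.of fun i j => 1 / (y j - x i) with hC
  have hU : IsUnit C.det := by
    rw [isUnit_iff_ne_zero]
    intro h
    obtain ⟨w, hw0, hw⟩ := Matrix.exists_mulVec_eq_zero_iff.mpr h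
    exact hw0 (aux_ker x y w hx hy hxy hxi hyi fun i => congrFun hw i)
  have solve : ∀ a, C.mulVec (C⁻¹.mulVec a) = a := fun a => by
    rw [Matrix.mulVec_mulVec, Matrix.mul_nonsing_inv _ hU, Matrix.one_mulVec]
  obtain ⟨w, hw⟩ : ∃ w, C.mulVec w = fun _ => 1 := ⟨_, solve _⟩
  obtain ⟨v, hv⟩ : ∃ v, C.mulVec v = fun i => 1 / x i := ⟨_, solve _⟩
  obtain ⟨w1, w2⟩ := aux_w x y w hx hxy hxi fun i => congrFun hw i
  obtain ⟨v1, v2⟩ := aux_v x y v hx hxy hxi fun i => congrFun hv i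
  have e : ∀ i j, z / (x i - y j) * (y j / x i) + 1 / (y j - x i) * (x i / y j)
      = (1 - z) * (1 / (y j - x i)) - (1 * (1 / y j) + 1 / x i * z) := by
    intro i j
    have h1 := hx i
    have h2 := hy j
    have h3 : y j - x i ≠ 0 := sub_ne_zero.mpr (hxy i j).symm
    have h4 : x i - y j = - (y j - x i) := by ring
    rw [h4]
    field_simp
    ring
  have k1 := aux_rank_two C (fun _ => 1) (fun j => 1 / y j) (fun i => 1 / x i) (fun _ => z) w v
    hU hw hv (1 - z)
  have k2 := aux_rank_two C (fun _ => 1) (fun j => 1 / y j + y j) (fun i => 1 / x i)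
    (fun _ => z) w v hU hw hv (1 - z)
  have m1 : (Matrix.of fun i j : Fin (n + 2) =>
        z / (x i - y j) * (y j / x i) + 1 / (y j - x i) * (x i / y j))
      = (1 - z) • C - Matrix.of fun i j => 1 * (1 / y j) + 1 / x i * z := by
    ext i j
    simp only [Matrix.of_apply, Matrix.sub_apply, Matrix.smul_apply, hC, smul_eq_mul, e]
  have m2 : (Matrix.of fun i j : Fin (n + 2) =>
        z / (x i - y j) * (y j / x i) + 1 / (y j - x i) * (x i / y j)) -
        (Matrix.of fun _ j => y j)
      = (1 - z) • C - Matrix.of fun i j => 1 * (1 / y j + y j) + 1 / x i * z := by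
    ext i j
    simp only [Matrix.of_apply, Matrix.sub_apply, Matrix.smul_apply, hC, smul_eq_mul, e]
    ring
  rw [m2, m1, k1, k2]
  simp only [dotProduct, add_mul, Finset.sum_add_distrib, ← Finset.mul_sum, w1, w2, v1, v2]
  simp only [Hhat]
  ring
end

section
/- With the notation C_{p,q} := ∑_{a,b=1}^N x_a^p y_b^q · Y(x_a)X(y_b) / ((x_a−y_b) X'(x_a) Y'(y_b)), one has C_{-1,2} = (∏_i y_i/x_i) · Ĥ(X;Y), where Ĥ(X;Y) = (1/2)(∑_i x_i − ∑_i y_i)^2 − (1/2)(∑_i x_i^2 − ∑_i y_i^2). -/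
open Finset

/-- `C_{p,q} = ∑_{a,b} x_a^p y_b^q · Y(x_a) X(y_b) / ((x_a−y_b) X'(x_a) Y'(y_b))`. -/
noncomputable def Cpq {N : ℕ} (x y : Fin N → ℂ) (p q : ℤ) : ℂ :=
  ∑ a, ∑ b, x a ^ p * y b ^ q *
    (∏ i, (x a - y i)) * (∏ i, (y b - x i)) /
    ((x a - y b) * (∏ i ∈ Finset.univ.erase a, (x a - x i)) *
      (∏ i ∈ Finset.univ.erase b, (y b - y i)))

lemma aux_coeff (N : ℕ) (x : Fin N → ℂ) (s : Finset (Fin N)) :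
    (Polynomial.X * Lagrange.nodal s x).coeff #s = - ∑ i ∈ s, x i ∧
    (Polynomial.X * (Polynomial.X * Lagrange.nodal s x)).coeff #s =
      (1 / 2) * ((∑ i ∈ s, x i) ^ 2 - ∑ i ∈ s, x i ^ 2) := by
  classical
  induction s using Finset.induction_on with
  | empty => simp
  | insert a s ha ih =>
    obtain ⟨h1, h2⟩ := ih
    have h0 : (Lagrange.nodal s x).coeff #s = 1 := by
      have := (Lagrange.nodal_monic (s := s) (v := x)).coeff_natDegree
      rwa [Lagrange.natDegree_nodal] at this
    rw [Lagrange.nodal_insert_eq_nodal ha, card_insert_of_notMem ha, sum_insert ha, sum_insert ha]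
    constructor
    · rw [Polynomial.coeff_X_mul, sub_mul, Polynomial.coeff_sub, h1, Polynomial.coeff_C_mul, h0]
      ring
    · rw [Polynomial.coeff_X_mul, sub_mul, mul_sub, Polynomial.coeff_sub, h2,
        mul_left_comm, Polynomial.coeff_C_mul, h1]
      ring

lemma aux_y (N : ℕ) (x y : Fin N → ℂ) (hyinj : Function.Injective y) :
    ∑ b, y b * (∏ i, (y b - x i)) / (∏ i ∈ Finset.univ.erase b, (y b - y i)) = Hhat x y := by
  rcases N with _ | n
  · simp [Hhat]
  obtain ⟨hx1, hx2⟩ := aux_coeff _ x univ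
  obtain ⟨hy1, hy2⟩ := aux_coeff _ y univ
  have hX := Lagrange.nodal_monic (s := univ) (v := x)
  have hY := Lagrange.nodal_monic (s := univ) (v := y)
  have dX := Lagrange.natDegree_nodal (s := univ) (v := x)
  have dY := Lagrange.natDegree_nodal (s := univ) (v := y)
  have evX := fun b => Lagrange.eval_nodal (s := univ) (v := x) (x := y b)
  have evY := fun b => Lagrange.eval_nodal_at_node (v := y) (mem_univ b)
  generalize Lagrange.nodal univ x = P at *
  generalize Lagrange.nodal univ y = Q at *
  simp only [card_univ, Fintype.card_fin, Polynomial.coeff_X_mul] at hx1 hx2 hy1 hy2 dX dY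
  have lX := hX.coeff_natDegree
  have lY := hY.coeff_natDegree
  rw [dX] at lX
  rw [dY] at lY
  set c : ℂ := ∑ i, y i - ∑ i, x i with hc
  set R : Polynomial ℂ := Polynomial.X * P - (Polynomial.X * Q + Polynomial.C c * Q) with hR
  have hdeg : R.degree < #(univ : Finset (Fin (n+1))) := by
    rw [Polynomial.degree_lt_iff_coeff_zero]
    intro m hm
    simp only [card_univ, Fintype.card_fin] at hm
    obtain ⟨m, rfl⟩ : ∃ k, m = k + 1 := ⟨m - 1, by omega⟩
    simp only [hR, Polynomial.coeff_sub, Polynomial.coeff_add, Polynomial.coeff_X_mul,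
      Polynomial.coeff_C_mul]
    rcases (by omega : m = n ∨ m = n + 1 ∨ n + 1 < m) with rfl | rfl | h
    · rw [hx1, hy1, lY, hc]; ring
    · rw [lX, lY, Polynomial.coeff_eq_zero_of_natDegree_lt (by omega : Q.natDegree < _)]; ring
    · rw [Polynomial.coeff_eq_zero_of_natDegree_lt (by omega : Q.natDegree < m),
        Polynomial.coeff_eq_zero_of_natDegree_lt (by omega : Q.natDegree < m + 1),
        Polynomial.coeff_eq_zero_of_natDegree_lt (by omega : P.natDegree < m)]; ring
  have key := Lagrange.coeff_eq_sum (s := univ) (v := y) hyinj.injOn (P := R) (by simpa using hdeg)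
  simp [hR, evX, evY] at key
  rw [← key]
  simp only [hx2, hy2, hy1, Hhat, hc]
  ring

lemma aux_x (N : ℕ) (x y : Fin N → ℂ) (hxinj : Function.Injective x)
    (hx : ∀ i, x i ≠ 0) (hy : ∀ j, y j ≠ 0) (b : Fin N) :
    ∑ a, (x a)⁻¹ * (∏ i ∈ univ.erase b, (x a - y i)) / (∏ i ∈ Finset.univ.erase a, (x a - x i))
      = (∏ i, y i / x i) / y b := by
  have h1 := Lagrange.eq_interpolate (s := univ) (v := x) (f := Lagrange.nodal (univ.erase b) y)
    hxinj.injOn (by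
      rw [Lagrange.degree_nodal]
      exact_mod_cast card_lt_card (erase_ssubset (mem_univ b)))
  have h2 := congrArg (Polynomial.eval 0) h1
  rw [Lagrange.eval_interpolate_not_at_node _ (fun i _ => (hx i).symm)] at h2
  simp only [Lagrange.eval_nodal, zero_sub, prod_neg, Lagrange.nodalWeight, prod_inv_distrib] at h2
  have hc : #(univ : Finset (Fin N)) = #(univ.erase b) + 1 := by
    rw [card_erase_add_one (mem_univ b)]
  rw [hc, pow_succ] at h2
  have hp : ∏ i, x i ≠ 0 := prod_ne_zero_iff.2 fun i _ => hx i
  have hs : ((-1 : ℂ) ^ #(univ.erase b)) ≠ 0 := pow_ne_zero _ (by norm_num)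
  rw [mul_assoc, mul_assoc] at h2
  have h3 := mul_left_cancel₀ hs h2
  rw [prod_div_distrib, ← mul_prod_erase univ y (mem_univ b), mul_div_assoc,
    mul_div_cancel_left₀ _ (hy b), h3, eq_div_iff hp, mul_comm, neg_one_mul, ← mul_neg,
    ← sum_neg_distrib]
  congr 1
  refine sum_congr rfl fun a _ => ?_
  rw [inv_neg]
  ring

theorem stmt2 (N : ℕ) (x y : Fin N → ℂ)
    (hxinj : Function.Injective x) (hyinj : Function.Injective y)
    (hx : ∀ i, x i ≠ 0) (hy : ∀ j, y j ≠ 0)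
    (hxy : ∀ i j, x i ≠ y j) :
    Cpq x y (-1) 2 = (∏ i, y i / x i) * Hhat x y := by
  rw [← aux_y N x y hyinj, Cpq, sum_comm, mul_sum]
  refine sum_congr rfl fun b _ => ?_
  have h := aux_x N x y hxinj hx hy b
  have e : (∏ i, y i / x i) = y b * ((∏ i, y i / x i) / y b) := by
    rw [mul_div_cancel₀ _ (hy b)]
  rw [e, ← h, mul_sum, sum_mul]
  refine sum_congr rfl fun a _ => ?_
  rw [← mul_prod_erase univ (fun i => x a - y i) (mem_univ b), zpow_neg_one]
  have h1 : x a - y b ≠ 0 := sub_ne_zero.2 (hxy a b)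
  have h2 : ∏ i ∈ univ.erase a, (x a - x i) ≠ 0 := prod_ne_zero_iff.2 fun i hi =>
    sub_ne_zero.2 fun h => (ne_of_mem_erase hi) (hxinj h).symm
  have h3 : ∏ i ∈ univ.erase b, (y b - y i) ≠ 0 := prod_ne_zero_iff.2 fun i hi =>
    sub_ne_zero.2 fun h => (ne_of_mem_erase hi) (hyinj h).symm
  have h4 := hx a
  have h5 : y b ^ (2 : ℤ) = y b * y b := by rw [zpow_ofNat, sq]
  rw [h5]
  field_simp
end

section
/- With the notation C_{p,q} := ∑_{a,b=1}^N x_a^p y_b^q · Y(x_a)X(y_b) / ((x_a−y_b) X'(x_a) Y'(y_b)), one has C_{0,2} − C_{1,1} = −(∑_i (x_i − y_i)) · Ĥ(X;Y), where Ĥ(X;Y) = (1/2)(∑_i x_i − ∑_i y_i)^2 − (1/2)(∑_i x_i^2 − ∑_i y_i^2). -/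
open Finset

open Polynomial in
lemma nod_coeff {N : ℕ} (x : Fin N → ℂ) (s : Finset (Fin N)) :
    (X ^ 2 * Lagrange.nodal s x : ℂ[X]).coeff (#s + 2) = 1 ∧
    (X ^ 2 * Lagrange.nodal s x : ℂ[X]).coeff (#s + 1) = - ∑ i ∈ s, x i ∧
    (X ^ 2 * Lagrange.nodal s x : ℂ[X]).coeff (#s) =
      ((∑ i ∈ s, x i) ^ 2 - ∑ i ∈ s, x i ^ 2) / 2 ∧
    (∀ m, #s + 2 < m → (X ^ 2 * Lagrange.nodal s x : ℂ[X]).coeff m = 0) := by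
  classical
  induction s using Finset.induction_on with
  | empty =>
    simp [coeff_X_pow]
    intro m hm; omega
  | insert a s ha ih =>
    obtain ⟨h1, h2, h3, h4⟩ := ih
    have key : ∀ n, (X ^ 2 * Lagrange.nodal (insert a s) x : ℂ[X]).coeff (n + 1) =
        (X ^ 2 * Lagrange.nodal s x : ℂ[X]).coeff n
          - x a * (X ^ 2 * Lagrange.nodal s x : ℂ[X]).coeff (n + 1) := by
      intro n
      rw [Lagrange.nodal_insert_eq_nodal ha,
        show (X ^ 2 * ((X - C (x a)) * Lagrange.nodal s x) : ℂ[X]) =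
          X * (X ^ 2 * Lagrange.nodal s x) - C (x a) * (X ^ 2 * Lagrange.nodal s x) by ring,
        coeff_sub, coeff_X_mul, coeff_C_mul]
    rw [card_insert_of_notMem ha, sum_insert ha, sum_insert ha]
    refine ⟨?_, ?_, ?_, ?_⟩
    · rw [show #s + 1 + 2 = (#s + 2) + 1 by ring, key, h1, h4 _ (by omega)]; ring
    · rw [key, h1, h2]; ring
    · rw [key, h3, h2]; ring
    · intro m hm
      obtain ⟨k, rfl⟩ : ∃ k, m = k + 1 := ⟨m - 1, by omega⟩
      rw [key, h4 _ (by omega), h4 _ (by omega)]; ring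

open Polynomial in
lemma sum_res {N : ℕ} (x : Fin N → ℂ) (hx : Function.Injective x) (f : ℂ[X])
    (hf : ∀ m, N + 2 ≤ m → (X ^ 2 * f).coeff m = 0) :
    ∑ a, f.eval (x a) / (∏ i ∈ Finset.univ.erase a, (x a - x i)) = (X ^ 2 * f).coeff (N + 1) := by
  have hd : f.degree < N := by
    rw [degree_lt_iff_coeff_zero]
    intro m hm
    have := hf (m + 2) (by omega)
    rwa [mul_comm, coeff_mul_X_pow] at this
  rcases N with _ | n
  · have : f = 0 := by
      rw [← degree_eq_bot]
      exact Nat.WithBot.lt_zero_iff.mp (by simpa using hd)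
    simp [this]
  · rw [show n + 1 + 1 = n + 2 by ring, mul_comm, coeff_mul_X_pow]
    have := Lagrange.coeff_eq_sum (s := Finset.univ) (v := x) (hx.injOn) (P := f) (by simpa using hd)
    simpa using this.symm

open Polynomial in
lemma sum_zero {N : ℕ} (x y : Fin N → ℂ) (hx : Function.Injective x) :
    ∑ a, (∏ i, (x a - y i)) / (∏ i ∈ Finset.univ.erase a, (x a - x i)) =
      ∑ i, x i - ∑ i, y i := by
  obtain ⟨a1, a2, a3, a4⟩ := nod_coeff x univ
  obtain ⟨b1, b2, b3, b4⟩ := nod_coeff y univ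
  simp only [card_univ, Fintype.card_fin] at a1 a2 a3 a4 b1 b2 b3 b4
  have := sum_res x hx (Lagrange.nodal univ y - Lagrange.nodal univ x) (by
    intro m hm
    rw [mul_sub, coeff_sub]
    rcases hm.eq_or_lt with rfl | h
    · rw [a1, b1]; ring
    · rw [a4 _ h, b4 _ h]; ring)
  rw [mul_sub, coeff_sub, a2, b2] at this
  simp only [eval_sub, Lagrange.eval_nodal_at_node (mem_univ _), sub_zero,
    Lagrange.eval_nodal] at this
  rw [this]; ring

open Polynomial in
lemma sum_one {N : ℕ} (x y : Fin N → ℂ) (hy : Function.Injective y) :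
    ∑ b, y b * (∏ i, (y b - x i)) / (∏ i ∈ Finset.univ.erase b, (y b - y i)) = Hhat x y := by
  obtain ⟨a1, a2, a3, a4⟩ := nod_coeff x univ
  obtain ⟨b1, b2, b3, b4⟩ := nod_coeff y univ
  simp only [card_univ, Fintype.card_fin] at a1 a2 a3 a4 b1 b2 b3 b4
  set P := Lagrange.nodal univ x
  set Q := Lagrange.nodal univ y with hQ
  have key : ∀ n, (X ^ 2 * (X * (P - Q) - C (∑ i, y i - ∑ i, x i) * Q)).coeff (n + 1) =
      (X ^ 2 * P).coeff n - (X ^ 2 * Q).coeff n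
        - (∑ i, y i - ∑ i, x i) * (X ^ 2 * Q).coeff (n + 1) := by
    intro n
    rw [show X ^ 2 * (X * (P - Q) - C (∑ i, y i - ∑ i, x i) * Q) =
      X * (X ^ 2 * P - X ^ 2 * Q) - C (∑ i, y i - ∑ i, x i) * (X ^ 2 * Q) by ring,
      coeff_sub, coeff_X_mul, coeff_C_mul, coeff_sub]
  have := sum_res y hy (X * (P - Q) - C (∑ i, y i - ∑ i, x i) * Q) (by
    intro m hm
    obtain ⟨k, rfl⟩ : ∃ k, m = k + 1 := ⟨m - 1, by omega⟩
    rw [key]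
    obtain h | h | h : k = N + 1 ∨ k = N + 2 ∨ N + 2 < k := by omega
    · subst h; rw [a2, b2, b1]; ring
    · subst h; rw [a1, b1, b4 _ (by omega)]; ring
    · rw [a4 _ h, b4 _ h, b4 _ (by omega)]; ring)
  rw [key, a3, b3, b2] at this
  have hz : ∀ b, Q.eval (y b) = 0 := fun b => Lagrange.eval_nodal_at_node (mem_univ _)
  simp only [eval_sub, eval_mul, hz, eval_X, mul_zero, sub_zero] at this
  simp only [P, Lagrange.eval_nodal] at this
  rw [this, Hhat]; ring

theorem stmt5 (N : ℕ) (x y : Fin N → ℂ)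
    (hxinj : Function.Injective x) (hyinj : Function.Injective y)
    (hxy : ∀ i j, x i ≠ y j) :
    Cpq x y 0 2 - Cpq x y 1 1 = -(∑ i, (x i - y i)) * Hhat x y := by
  rw [← sum_one x y hyinj, sum_sub_distrib, ← sum_zero x y hxinj, neg_mul, sum_mul_sum,
    Cpq, Cpq, ← sum_sub_distrib, ← sum_neg_distrib]
  refine sum_congr rfl fun a _ => ?_
  rw [← sum_sub_distrib, ← sum_neg_distrib]
  refine sum_congr rfl fun b _ => ?_
  have h1 : x a - y b ≠ 0 := sub_ne_zero.mpr (hxy a b)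
  have h2 : ∏ i ∈ Finset.univ.erase a, (x a - x i) ≠ 0 :=
    prod_ne_zero_iff.mpr fun i hi => sub_ne_zero.mpr fun h => (mem_erase.mp hi).1 (hxinj h).symm
  have h3 : ∏ i ∈ Finset.univ.erase b, (y b - y i) ≠ 0 :=
    prod_ne_zero_iff.mpr fun i hi => sub_ne_zero.mpr fun h => (mem_erase.mp hi).1 (hyinj h).symm
  rw [zpow_zero, zpow_one, zpow_one, show (2 : ℤ) = ((2 : ℕ) : ℤ) from rfl, zpow_natCast]
  generalize ∏ i ∈ Finset.univ.erase a, (x a - x i) = p at *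
  generalize ∏ i ∈ Finset.univ.erase b, (y b - y i) = q at *
  generalize ∏ i, (x a - y i) = r
  generalize ∏ i, (y b - x i) = t
  field_simp
  ring
end

section
/- Cauchy-type double summation formula: For complex vectors W=(w_1,...,w_k) and W'=(w'_1,...,w'_k) with w_i ≠ w'_{i'} for all pairs, and integers a ≤ b, the sum Ŝ_{a,b}(W,W') := ∑_{a ≤ x_1 ≤ ... ≤ x_k ≤ b} det[ (w_i+1)^{x_j} w_i^j ]_{i,j=1}^k · det[ (w'_i+1)^{−x_j} (w'_i)^{−j} ]_{i,j=1}^k equals det[ (1/(w'_{i'} − w_i)) · w_i(w_i+1)^a / (w'_{i'}(w'_{i'}+1)^{a−1}) + (1/(w_i − w'_{i'})) · w_i^k (w_i+1)^{b+1} / ((w'_{i'})^k (w'_{i'}+1)^b) ]_{i,i'=1}^k. -/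
open Finset

lemma det_rank_one_aux {n : ℕ} (E : Matrix (Fin n) (Fin n) ℂ) (u v : Fin n → ℂ) (s : Finset (Fin n)) :
    Matrix.det (Matrix.of fun i j => E i j + if j ∈ s then u i * v j else 0)
      = E.det + ∑ j ∈ s, v j * (E.updateCol j u).det := by
  induction s using Finset.induction_on with
  | empty => simp; rfl
  | insert j0 s hj ih =>
    rw [Finset.sum_insert hj]
    have h1 : (Matrix.of fun i j => E i j + if j ∈ insert j0 s then u i * v j else 0)
       = (Matrix.of fun i j => E i j + if j ∈ s then u i * v j else 0).updateCol j0
          ((fun i => E i j0) + v j0 • u) := by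
      ext i j
      by_cases h : j = j0
      · subst h; simp [mul_comm]
      · simp [h]
    have h2 : (Matrix.of fun i j => E i j + if j ∈ s then u i * v j else 0).updateCol j0
          (fun i => E i j0) = (Matrix.of fun i j => E i j + if j ∈ s then u i * v j else 0) := by
      ext i j
      by_cases h : j = j0
      · subst h; simp [hj]
      · simp [h]
    have h3 : ((Matrix.of fun i j => E i j + if j ∈ s then u i * v j else 0).updateCol j0 u).det
        = (E.updateCol j0 u).det := by
      rw [← Matrix.det_transpose, ← Matrix.det_transpose (E.updateCol j0 u)]
      refine Matrix.det_eq_of_forall_row_eq_smul_add_const (fun j => if j ∈ s then v j else 0) j0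
        (by simp [hj]) ?_
      intro i j
      by_cases h : i = j0
      · subst h; simp [hj]
      · by_cases h' : i ∈ s <;> simp [h, h', mul_comm]
    rw [h1, Matrix.det_updateCol_add, Matrix.det_updateCol_smul, h2, h3, ih]
    ring

lemma det_rank_one {n : ℕ} (E : Matrix (Fin (n+1)) (Fin (n+1)) ℂ) (u v : Fin (n+1) → ℂ) :
    Matrix.det (Matrix.of fun i j => E i j + u i * v j)
      = E.det + ∑ i, ∑ j, (-1) ^ (i.1 + j.1) * (u i * v j) *
          (E.submatrix i.succAbove j.succAbove).det := by
  have h := det_rank_one_aux E u v Finset.univ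
  simp only [Finset.mem_univ, if_true] at h
  rw [h, Finset.sum_comm]
  congr 1
  refine Finset.sum_congr rfl fun j _ => ?_
  rw [Matrix.det_succ_column _ j, Finset.mul_sum]
  refine Finset.sum_congr rfl fun i _ => ?_
  simp only [Matrix.updateCol_self, Matrix.submatrix_updateCol_succAbove]
  ring

lemma det_rank_one_sub {n : ℕ} (E A B : Matrix (Fin (n+1)) (Fin (n+1)) ℂ) (u u' d v : Fin (n+1) → ℂ)
    (hA : ∀ i j, A i j = E i j + u i * v j) (hB : ∀ i j, B i j = E i j + u' i * v j)
    (hd : ∀ i, u i - u' i = d i) :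
    A.det = B.det + ∑ i, ∑ j, (-1) ^ (i.1 + j.1) * (d i * v j) *
          (E.submatrix i.succAbove j.succAbove).det := by
  have hA' : A = Matrix.of fun i j => E i j + u i * v j := by ext i j; simp [hA]
  have hB' : B = Matrix.of fun i j => E i j + u' i * v j := by ext i j; simp [hB]
  rw [hA', hB', det_rank_one, det_rank_one, add_assoc, ← Finset.sum_add_distrib]
  congr 1
  refine Finset.sum_congr rfl fun i _ => ?_
  rw [← Finset.sum_add_distrib]
  refine Finset.sum_congr rfl fun j _ => ?_
  rw [← hd]; ring

lemma det_low_rank {n : ℕ} (u v w w' : Fin (n+1) → ℂ) :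
    Matrix.det (Matrix.of fun i j : Fin (n+1) => u i * v j *
      ∑ l ∈ range n, w i ^ l * w' j ^ (n - 1 - l)) = 0 := by
  have : (Matrix.of fun i j : Fin (n+1) => u i * v j *
      ∑ l ∈ range n, w i ^ l * w' j ^ (n - 1 - l))
      = (Matrix.of fun i l : Fin (n+1) => if l.1 < n then u i * w i ^ l.1 else 0) *
        (Matrix.of fun l j : Fin (n+1) => v j * w' j ^ (n - 1 - l.1)) := by
    ext i j
    simp only [Matrix.mul_apply, Matrix.of_apply]
    rw [Fin.sum_univ_castSucc, Finset.sum_range, Finset.mul_sum]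
    simp
    refine Finset.sum_congr rfl fun l _ => ?_
    ring
  rw [this, Matrix.det_mul, Matrix.det_eq_zero_of_column_eq_zero (Fin.last n), zero_mul]
  simp

/-- monotone sequences in `[a,b]` -/
noncomputable def PP (n : ℕ) (a b : ℤ) : Finset (Fin n → ℤ) :=
  {X ∈ Fintype.piFinset fun _ => Icc a b | Monotone X}

lemma mem_PP {n : ℕ} {a b : ℤ} {X : Fin n → ℤ} :
    X ∈ PP n a b ↔ Monotone X ∧ ∀ j, a ≤ X j ∧ X j ≤ b := by
  simp [PP, and_comm]

lemma sum_PP_succ (n : ℕ) (a b : ℤ) (hab : a ≤ b) (F : (Fin (n+1) → ℤ) → ℂ) :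
    ∑ X ∈ PP (n+1) a b, F X = ∑ X ∈ PP (n+1) a (b-1), F X
      + ∑ X ∈ PP n a b, F (Fin.snoc (α := fun _ => ℤ) X b) := by
  rw [← Finset.sum_filter_add_sum_filter_not _ (fun X => X (Fin.last n) ≤ b - 1)]
  congr 1
  · refine Finset.sum_congr ?_ fun _ _ => rfl
    ext X
    simp only [mem_filter, mem_PP]
    constructor
    · rintro ⟨⟨h1, h2⟩, h3⟩
      exact ⟨h1, fun j => ⟨(h2 j).1, (h1 (Fin.le_last j)).trans h3⟩⟩
    · rintro ⟨h1, h2⟩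
      exact ⟨⟨h1, fun j => ⟨(h2 j).1, by linarith [(h2 j).2]⟩⟩, (h2 _).2⟩
  · refine Finset.sum_bij' (fun X _ => Fin.init X) (fun X _ => Fin.snoc (α := fun _ => ℤ) X b)
      ?_ ?_ ?_ ?_ ?_
    · intro X hX
      simp only [mem_filter, mem_PP] at hX ⊢
      exact ⟨fun i j hij => hX.1.1 (by simpa using hij), fun j => hX.1.2 _⟩
    · intro X hX
      simp only [mem_filter, mem_PP] at hX ⊢
      refine ⟨⟨?_, ?_⟩, by simp⟩
      · intro i j
        refine Fin.lastCases ?_ (fun j => ?_) j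
        · refine Fin.lastCases ?_ (fun i => ?_) i
          · simp
          · simp [(hX.2 i).2]
        · refine Fin.lastCases ?_ (fun i => ?_) i
          · intro h; exact absurd h (by simp)
          · intro h; simpa using hX.1 (by simpa using h)
      · intro j
        refine Fin.lastCases ?_ (fun j => ?_) j
        · simp [hab]
        · simpa using hX.2 j
    · intro X hX
      simp only [mem_filter, mem_PP] at hX
      have : b = X (Fin.last n) := by have := (hX.1.2 (Fin.last n)).2; omega
      rw [this]; exact Fin.snoc_init_self X
    · intro X hX
      simp
    · intro X hX
      simp only [mem_filter, mem_PP] at hX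
      have : b = X (Fin.last n) := by have := (hX.1.2 (Fin.last n)).2; omega
      rw [this]; congr 1; exact (Fin.snoc_init_self X).symm

noncomputable def ent (k : ℕ) (a b : ℤ) (p q : ℂ) : ℂ :=
  1 / (q - p) * (p * (p + 1) ^ a) / (q * (q + 1) ^ (a - 1))
        + 1 / (p - q) * (p ^ k * (p + 1) ^ (b + 1)) / (q ^ k * (q + 1) ^ b)

lemma ent_succ (m : ℕ) (a b : ℤ) (p q : ℂ) (hp1 : p + 1 ≠ 0)
    (hq0 : q ≠ 0) (hq1 : q + 1 ≠ 0) (hpq : p - q ≠ 0) :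
    ent (m+1) a b p q = ent m a b p q
      + ((p + 1) ^ (b+1) * p ^ m) * ((q+1) ^ (-b) * q ^ (-((m:ℤ)+1))) := by
  have hz : q ^ (-((m:ℤ)+1)) = (q ^ (m+1))⁻¹ := by rw [zpow_neg]; norm_cast
  rw [ent, ent, hz, zpow_neg, add_assoc]
  congr 1
  rw [zpow_add₀ hp1, zpow_one]
  have hB := zpow_ne_zero b hq1
  generalize (q+1) ^ b = Q at *
  field_simp
  ring

lemma ent_pred (m : ℕ) (a b : ℤ) (p q : ℂ) (hp1 : p + 1 ≠ 0)
    (hq0 : q ≠ 0) (hq1 : q + 1 ≠ 0) (hpq : p - q ≠ 0) :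
    ent (m+1) a (b-1) p q = ent m a b p q
      + ((p + 1) ^ b * p ^ m) * ((q+1) ^ (-b) * q ^ (-((m:ℤ)+1))) := by
  have hz : q ^ (-((m:ℤ)+1)) = (q ^ (m+1))⁻¹ := by rw [zpow_neg]; norm_cast
  rw [ent, ent, hz, zpow_neg, add_assoc]
  congr 1
  rw [sub_add_cancel, zpow_add₀ hp1, zpow_one, zpow_sub₀ hq1, zpow_one]
  have hB := zpow_ne_zero b hq1
  generalize (q+1) ^ b = Q at *
  field_simp
  ring

lemma ent_base (n : ℕ) (a : ℤ) (p q : ℂ)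
    (hq0 : q ≠ 0) (hq1 : q + 1 ≠ 0) (hpq : p - q ≠ 0) :
    ent (n+1) a (a-1) p q = (p * (p+1)^a) * (q ^ (n+1) * (q+1)^(a-1))⁻¹ *
      ∑ l ∈ range n, p ^ l * q ^ (n - 1 - l) := by
  have h := geom_sum₂_mul p q n
  have hqp : q - p ≠ 0 := fun h => hpq (by linear_combination -h)
  rw [← eq_div_iff hpq] at h
  rw [h, ent, sub_add_cancel, ← neg_sub p q]
  have hB := zpow_ne_zero (a-1) hq1
  generalize (q+1) ^ (a-1) = Q at *
  field_simp
  ring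

lemma main_aux (n : ℕ) : ∀ (w w' : Fin n → ℂ),
    (∀ i, w i + 1 ≠ 0) → (∀ i, w' i ≠ 0) → (∀ i, w' i + 1 ≠ 0) →
    (∀ i i', w i - w' i' ≠ 0) → ∀ (a : ℤ) (m : ℕ),
    ∑ X ∈ PP n a (a - 1 + m),
      Matrix.det (Matrix.of fun i j : Fin n =>
        (w i + 1) ^ (X j) * (w i) ^ (j.1 + 1)) *
      Matrix.det (Matrix.of fun i j : Fin n =>
        (w' i + 1) ^ (-(X j)) * (w' i) ^ (-((j.1 : ℤ) + 1)))
    = Matrix.det (Matrix.of fun i i' : Fin n => ent n a (a - 1 + m) (w i) (w' i')) := by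
  induction n with
  | zero =>
    intro w w' _ _ _ _ a m
    have : PP 0 a (a - 1 + m) = {Fin.elim0} := by
      ext X
      simp only [mem_PP, mem_singleton]
      refine ⟨fun _ => Subsingleton.elim _ _, fun _ => ⟨fun i => i.elim0, fun i => i.elim0⟩⟩
    rw [this]
    simp
  | succ n ih =>
    intro w w' hw1 hw'0 hw'1 hww a m
    induction m with
    | zero =>
      have : PP (n+1) a (a - 1 + (0:ℕ)) = ∅ := by
        ext X
        simp only [mem_PP, notMem_empty, iff_false]
        rintro ⟨_, h⟩
        have := h 0
        omega
      rw [this, Finset.sum_empty]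
      have e : (Matrix.of fun i i' : Fin (n+1) => ent (n+1) a (a - 1 + (0:ℕ)) (w i) (w' i')) =
        Matrix.of fun i i' : Fin (n+1) => (w i * (w i+1)^a) *
          (w' i' ^ (n+1) * (w' i'+1)^(a-1))⁻¹ * ∑ l ∈ range n, w i ^ l * w' i' ^ (n - 1 - l) := by
        ext i i'
        simp only [Matrix.of_apply, Nat.cast_zero, add_zero]
        exact ent_base n a _ _ (hw'0 i') (hw'1 i') (hww i i')
      rw [e]
      exact (det_low_rank (fun i => w i * (w i+1)^a)
        (fun i' => (w' i' ^ (n+1) * (w' i'+1)^(a-1))⁻¹) w w').symm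
    | succ m ihm =>
      have hb : a - 1 + (m:ℤ) = (a - 1 + ((m+1 : ℕ):ℤ)) - 1 := by push_cast; ring
      have IH := fun (i i' : Fin (n+1)) => ih (fun x => w (i.succAbove x)) (fun x => w' (i'.succAbove x))
        (fun _ => hw1 _) (fun _ => hw'0 _) (fun _ => hw'1 _) (fun _ _ => hww _ _) a (m+1)
      have hab : a ≤ a - 1 + ((m+1 : ℕ):ℤ) := by push_cast; omega
      rw [hb] at ihm
      generalize a - 1 + ((m+1 : ℕ):ℤ) = b at *
      rw [sum_PP_succ _ _ _ hab, ihm]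
      rw [det_rank_one_sub (Matrix.of fun i i' : Fin (n+1) => ent n a b (w i) (w' i'))
        (Matrix.of fun i i' : Fin (n+1) => ent (n+1) a b (w i) (w' i'))
        (Matrix.of fun i i' : Fin (n+1) => ent (n+1) a (b-1) (w i) (w' i'))
        (fun i => (w i + 1) ^ (b+1) * w i ^ n) (fun i => (w i + 1) ^ b * w i ^ n)
        (fun i => (w i + 1) ^ b * w i ^ (n+1))
        (fun i => (w' i + 1) ^ (-b) * w' i ^ (-((n:ℤ)+1)))
        (fun i j => ent_succ n a b _ _ (hw1 i) (hw'0 j) (hw'1 j) (hww i j))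
        (fun i j => ent_pred n a b _ _ (hw1 i) (hw'0 j) (hw'1 j) (hww i j))
        (fun i => by rw [zpow_add₀ (hw1 i), zpow_one]; ring)]
      congr 1
      have key : ∀ i i' : Fin (n+1), ((Matrix.of fun i i' : Fin (n+1) =>
          ent n a b (w i) (w' i')).submatrix i.succAbove i'.succAbove).det = _ :=
        fun i i' => (IH i i').symm
      simp_rw [key, Finset.mul_sum]
      rw [Finset.sum_congr rfl fun i _ => Finset.sum_comm, Finset.sum_comm]
      refine Finset.sum_congr rfl fun X _ => ?_
      rw [Matrix.det_succ_column _ (Fin.last n),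
        Matrix.det_succ_column (Matrix.of fun i j : Fin (n+1) =>
          (w' i + 1) ^ (-(Fin.snoc (α := fun _ => ℤ) X b j : ℤ)) * (w' i) ^ (-((j.1 : ℤ) + 1)))
          (Fin.last n),
        Finset.sum_mul_sum]
      refine Finset.sum_congr rfl fun i _ => Finset.sum_congr rfl fun i' _ => ?_
      have s1 : ((Matrix.of fun i j : Fin (n+1) =>
          (w i + 1) ^ (Fin.snoc (α := fun _ => ℤ) X b j : ℤ) * (w i) ^ (j.1 + 1)).submatrix
            i.succAbove (Fin.last n).succAbove) = Matrix.of fun x j : Fin n =>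
          (w (i.succAbove x) + 1) ^ (X j) * (w (i.succAbove x)) ^ (j.1 + 1) := by
        ext x j; simp
      have s2 : ((Matrix.of fun i j : Fin (n+1) =>
          (w' i + 1) ^ (-(Fin.snoc (α := fun _ => ℤ) X b j : ℤ)) *
            (w' i) ^ (-((j.1 : ℤ) + 1))).submatrix
            i'.succAbove (Fin.last n).succAbove) = Matrix.of fun x j : Fin n =>
          (w' (i'.succAbove x) + 1) ^ (-(X j)) * (w' (i'.succAbove x)) ^ (-((j.1:ℤ) + 1)) := by
        ext x j; simp
      rw [s1, s2]
      simp only [Matrix.of_apply, Fin.snoc_last, Fin.val_last]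
      have hs : ((-1:ℂ)) ^ (i.1 + i'.1) = (-1) ^ (i.1 + n) * (-1) ^ (i'.1 + n) := by
        rw [← pow_add, show i.1 + n + (i'.1 + n) = i.1 + i'.1 + 2 * n by ring, pow_add _ _ (2 * n),
          pow_mul (-1:ℂ) 2]
        simp
      rw [hs]
      ring



/-- Lemma 2.3 of the paper: Cauchy-type double summation formula `Ŝ_{a,b}(W,W')`. -/
theorem stmt10 (k : ℕ) (w w' : Fin k → ℂ)
    (hw0 : ∀ i, w i ≠ 0) (hw1 : ∀ i, w i ≠ -1)
    (hw'0 : ∀ i, w' i ≠ 0) (hw'1 : ∀ i, w' i ≠ -1)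
    (hww' : ∀ i i', w i ≠ w' i') (a b : ℤ) (hab : a ≤ b) :
    (∑' X : {X : Fin k → ℤ // Monotone X ∧ ∀ j, a ≤ X j ∧ X j ≤ b},
      Matrix.det (Matrix.of fun i j : Fin k =>
        (w i + 1) ^ (X.1 j) * (w i) ^ (j.1 + 1)) *
      Matrix.det (Matrix.of fun i j : Fin k =>
        (w' i + 1) ^ (-(X.1 j)) * (w' i) ^ (-((j.1 : ℤ) + 1))))
    = Matrix.det (Matrix.of fun i i' : Fin k =>
        1 / (w' i' - w i) * (w i * (w i + 1) ^ a) / (w' i' * (w' i' + 1) ^ (a - 1))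
        + 1 / (w i - w' i') * ((w i) ^ k * (w i + 1) ^ (b + 1)) /
            ((w' i') ^ k * (w' i' + 1) ^ b)) := by
  have h := main_aux k w w' (fun i h => hw1 i (by linear_combination h)) hw'0
    (fun i h => hw'1 i (by linear_combination h)) (fun i i' => sub_ne_zero.mpr (hww' i i')) a
    (b - a + 1).toNat
  have hb : a - 1 + ((b - a + 1).toNat : ℤ) = b := by omega
  rw [hb] at h
  simp only [ent] at h
  rw [← h, ← Finset.tsum_subtype]
  let e : {X : Fin k → ℤ // Monotone X ∧ ∀ j, a ≤ X j ∧ X j ≤ b} ≃ {X // X ∈ PP k a b} :=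
    Equiv.subtypeEquivRight fun X => mem_PP.symm
  rw [← e.tsum_eq]
  rfl
end
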